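/- arXiv:1002.2313 — 4 statements merged into one kernel-verified Lean document; each statement's English description precedes it below -/
import Mathlib

section
/- The following four bounds hold: (1) inf{ K_h(x) : x ∈ L(t−ε0) } > 0; (2) sup{ q_h(x,y) : x ∈ L(t−ε0), y ∈ ℝ^d } < ∞; (3) sup{ ‖D_x q_h(x,y)‖ : (x,y) ∈ L(t−ε0) × ℝ^d } < ∞; (4) sup{ ‖D_x² q_h(x,y)‖ : (x,y) ∈ L(t−ε0) × ℝ^d } < ∞, where D_x q_h and D_x² q_h denote the differential and Hessian of q_h with respect to its first argument. -/
open MeasureTheory ProbabilityTheory Filter Set Metric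
open scoped Topology Classical ENNReal

noncomputable section

abbrev Ed (d : ℕ) := EuclideanSpace ℝ (Fin d)

/-- The scaled kernel `k_h(u) = k(u/h)`. -/
def kerh {d : ℕ} (k : Ed d → ℝ) (h : ℝ) (u : Ed d) : ℝ := k (h⁻¹ • u)

/-- `K_h(x) = ∫_{L(t)} k_h(y − x) μ^t(dy)` (the measure `μt` is meant to be the
conditional distribution of `μ` given the level set `L(t)`). -/
def KH {d : ℕ} (k : Ed d → ℝ) (h : ℝ) (μt : Measure (Ed d)) (x : Ed d) : ℝ :=
  ∫ y, kerh k h (y - x) ∂μt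

/-- `q_h(x,y) = k_h(y − x) / K_h(x)`. -/
def qH {d : ℕ} (k : Ed d → ℝ) (h : ℝ) (μt : Measure (Ed d)) (x y : Ed d) : ℝ :=
  kerh k h (y - x) / KH k h μt x


theorem aux_deriv_bound {E : Type*} [NormedAddCommGroup E] [NormedSpace ℝ E]
    {f : E → ℝ} {f' : E →L[ℝ] ℝ} {y0 : E} (hf : HasFDerivAt f f' y0) {C : ℝ} (hC : 0 ≤ C)
    (hb : ∀ᶠ y in 𝓝 y0, f y - f y0 ≤ C * ‖y - y0‖) : ‖f'‖ ≤ C := by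
  refine le_of_forall_pos_le_add fun ε ε0 => ContinuousLinearMap.opNorm_le_of_nhds_zero ?_ ?_
  · exact add_nonneg hC ε0.le
  rw [← map_add_left_nhds_zero y0, eventually_map] at hb
  have h1 : ∀ᶠ u in 𝓝 (0 : E), f' u ≤ (C + ε) * ‖u‖ := by
    filter_upwards [Asymptotics.isLittleO_iff.1 (hasFDerivAt_iff_isLittleO_nhds_zero.1 hf) ε0, hb]
      with u hu hbu
    rw [add_sub_cancel_left] at hbu
    have := (abs_le.1 (Real.norm_eq_abs _ ▸ hu)).1
    nlinarith
  have h2 : ∀ᶠ u in 𝓝 (0 : E), f' (-u) ≤ (C + ε) * ‖-u‖ := by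
    have : Tendsto (fun u : E => -u) (𝓝 0) (𝓝 0) := by
      simpa using (continuous_neg (G := E)).tendsto 0
    exact this.eventually h1
  filter_upwards [h1, h2] with u a b
  rw [map_neg, norm_neg] at b
  rw [Real.norm_eq_abs, abs_le]
  constructor <;> linarith

theorem aux_reach {d : ℕ} {t ε0 α0 r : ℝ} {f : Ed d → ℝ} (hf : Differentiable ℝ f)
    (hε0 : 0 < ε0) (hα0 : 0 < α0)
    (hα0le : ∀ x, t - ε0 ≤ f x → f x ≤ t → α0 ≤ ‖fderiv ℝ f x‖)
    (hr : ε0 / α0 < r) (x : Ed d) (hx : t - ε0 ≤ f x) :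
    ∃ z, t ≤ f z ∧ dist z x ≤ r := by
  by_contra! hcon
  have hr0 : 0 < r := lt_trans (by positivity) hr
  have h1 : ε0 / r < α0 := by
    rw [div_lt_iff₀ hα0] at hr
    rw [div_lt_iff₀ hr0]; linarith
  obtain ⟨a, ha1, ha2⟩ := exists_between h1
  have ha0 : 0 < a := lt_trans (by positivity) ha1
  rw [div_lt_iff₀ hr0] at ha1
  obtain ⟨y, hy, hmax⟩ := (isCompact_closedBall x r).exists_isMaxOn
    ⟨x, mem_closedBall_self hr0.le⟩
    (f := fun y => f y - a * dist y x) (by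
      have := hf.continuous
      fun_prop)
  have hlt : ∀ z ∈ closedBall x r, f z < t := by
    intro z hz
    by_contra! hzt
    exact absurd (hcon z hzt) (not_lt.2 hz)
  have hyx : f x + a * dist y x ≤ f y := by
    have := hmax (mem_closedBall_self hr0.le)
    simp at this
    linarith
  have hd : dist y x < r := by
    by_contra! hge
    have := hlt y hy
    nlinarith
  have hder : ‖fderiv ℝ f y‖ ≤ a := by
    refine aux_deriv_bound (hf y).hasFDerivAt ha0.le ?_
    filter_upwards [isOpen_ball.mem_nhds (mem_ball.2 hd)] with z hz
    have h2 := hmax (ball_subset_closedBall hz)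
    simp at h2
    have h3 := dist_triangle z y x
    rw [← dist_eq_norm]
    nlinarith
  have := hα0le y (by have := dist_nonneg (x := y) (y := x); nlinarith) (hlt y hy).le
  linarith

theorem aux_bound {X Y G : Type*} [TopologicalSpace X] [PseudoMetricSpace Y] [ProperSpace Y]
    [NormedAddCommGroup G] {C : Set X} (hC : IsCompact C) (S : Set Y) (hS : IsCompact S)
    (F : X × Y → G) (hF : ∀ x ∈ C, ∀ y, ContinuousAt F (x, y))
    (h0 : ∀ x ∈ C, ∀ y ∉ S, F (x, y) = 0) :
    ∃ M : ℝ, ∀ x ∈ C, ∀ y, ‖F (x, y)‖ ≤ M := by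
  obtain ⟨M, hM⟩ := (hC.prod hS).exists_bound_of_continuousOn (f := F)
    (fun p hp => (hF p.1 hp.1 p.2).continuousWithinAt)
  refine ⟨max M 0, fun x hx y => ?_⟩
  by_cases hy : y ∈ S
  · exact (hM (x, y) ⟨hx, hy⟩).trans (le_max_left _ _)
  · rw [h0 x hx y hy, norm_zero]; exact le_max_right _ _

theorem kerh_zero {d : ℕ} {k : Ed d → ℝ} {h : ℝ} (hh : 0 < h)
    (hksupp : tsupport k = Metric.closedBall 0 1) (u : Ed d) (hu : h < ‖u‖) :
    kerh k h u = 0 := by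
  unfold kerh
  apply image_eq_zero_of_notMem_tsupport
  rw [hksupp, mem_closedBall_zero_iff, norm_smul, norm_inv, Real.norm_of_nonneg hh.le, not_le,
    ← div_eq_inv_mul, lt_div_iff₀ hh]
  simpa using hu

theorem kerh_contDiff {d : ℕ} {k : Ed d → ℝ} {h : ℝ} (hkC2 : ContDiff ℝ 2 k) :
    ContDiff ℝ 2 (kerh k h) := by
  unfold kerh
  fun_prop

theorem kerh_compact {d : ℕ} {k : Ed d → ℝ} {h : ℝ} (hh : 0 < h)
    (hksupp : tsupport k = Metric.closedBall 0 1) : HasCompactSupport (kerh k h) := by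
  refine HasCompactSupport.intro (isCompact_closedBall 0 h) fun x hx => ?_
  exact kerh_zero hh hksupp x (by simpa using hx)

theorem KH_contDiff {d : ℕ} {k : Ed d → ℝ} {h : ℝ} (hh : 0 < h) (hkC2 : ContDiff ℝ 2 k)
    (hksupp : tsupport k = Metric.closedBall 0 1) (hksymm : ∀ x, k (-x) = k x)
    (ν : Measure (Ed d)) [IsFiniteMeasure ν] : ContDiff ℝ 2 (KH k h ν) := by
  have h1 := (kerh_compact hh hksupp).contDiff_convolution_right (n := 2) (μ := ν)
    (f := fun _ => (1 : ℝ)) (ContinuousLinearMap.mul ℝ ℝ)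
    (integrable_const (1 : ℝ)).locallyIntegrable (kerh_contDiff hkC2)
  suffices h2 : KH k h ν = convolution (fun _ => (1 : ℝ)) (kerh k h) (ContinuousLinearMap.mul ℝ ℝ) ν by
    rw [h2]; exact h1
  ext x
  unfold KH convolution
  refine integral_congr_ae (Eventually.of_forall fun y => ?_)
  simp only [ContinuousLinearMap.mul_apply', one_mul]
  unfold kerh
  rw [← hksymm, ← smul_neg, neg_sub]

theorem aux_meas_pos {d : ℕ} {t : ℝ} (ht : 0 < t) {f : Ed d → ℝ} (hf : Continuous f)
    (hcrit : ∀ x, f x = t → fderiv ℝ f x ≠ 0) (U : Set (Ed d)) (hU : IsOpen U)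
    (z : Ed d) (hzU : z ∈ U) (hz : t ≤ f z) :
    0 < (MeasureTheory.volume.withDensity (fun x => ENNReal.ofReal (f x))) ({z | t ≤ f z} ∩ U) := by
  have h1 : ∃ w ∈ U, t < f w := by
    rcases hz.lt_or_eq with hz | hz
    · exact ⟨z, hzU, hz⟩
    · by_contra! hcon
      refine hcrit z hz.symm (IsLocalMax.fderiv_eq_zero ?_)
      filter_upwards [hU.mem_nhds hzU] with w hw
      rw [← hz]; exact hcon w hw
  obtain ⟨w, hwU, hw⟩ := h1
  have ho : IsOpen ({z | t < f z} ∩ U) := (isOpen_lt continuous_const hf).inter hU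
  have hv := ho.measure_pos (volume : Measure (Ed d)) ⟨w, hw, hwU⟩
  refine lt_of_lt_of_le ?_ (measure_mono (s := {z | t < f z} ∩ U) (by
    rintro y ⟨hy, hyU⟩; exact ⟨show t ≤ f y from le_of_lt hy, hyU⟩))
  rw [withDensity_apply _ ho.measurableSet]
  calc (0 : ℝ≥0∞) < ENNReal.ofReal t * volume ({z | t < f z} ∩ U) :=
        ENNReal.mul_pos (by simpa using ht) hv.ne'
    _ = ∫⁻ _ in ({z | t < f z} ∩ U), ENNReal.ofReal t := by rw [setLIntegral_const]
    _ ≤ _ := setLIntegral_mono' ho.measurableSet (fun y hy => ENNReal.ofReal_le_ofReal (le_of_lt hy.1))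

theorem KH_pos {d : ℕ} {k : Ed d → ℝ} {h : ℝ} (hh : 0 < h) (hkC2 : ContDiff ℝ 2 k)
    (hk0 : ∀ x, 0 ≤ k x)
    (hksupp : tsupport k = Metric.closedBall 0 1)
    (hklow : ∃ c > 0, ∀ x ∈ Metric.closedBall (0 : Ed d) (1 / 2), c ≤ k x)
    (ν : Measure (Ed d)) [IsFiniteMeasure ν] (x : Ed d) (hν : 0 < ν (ball x (h / 2))) :
    0 < KH k h ν x := by
  unfold KH
  have hcont : Continuous fun y => kerh k h (y - x) :=
    (kerh_contDiff hkC2).continuous.comp (continuous_id.sub continuous_const)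
  have hcs : HasCompactSupport fun y => kerh k h (y - x) := by
    refine HasCompactSupport.intro (isCompact_closedBall x h) fun y hy => ?_
    exact kerh_zero hh hksupp _ (by simpa [dist_eq_norm] using hy)
  rw [integral_pos_iff_support_of_nonneg (f := fun y => kerh k h (y - x)) (fun y => hk0 _) (hcont.integrable_of_hasCompactSupport hcs)]
  refine lt_of_lt_of_le hν (measure_mono fun y hy => ?_)
  obtain ⟨c, hc, hck⟩ := hklow
  have : c ≤ kerh k h (y - x) := by
    apply hck
    rw [mem_closedBall_zero_iff, norm_smul, norm_inv, Real.norm_of_nonneg hh.le,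
      ← div_eq_inv_mul, div_le_iff₀ hh]
    rw [mem_ball, dist_eq_norm] at hy
    linarith
  exact (lt_of_lt_of_le hc this).ne'

/-- Bounds on `K_h` and `q_h`: `K_h` is bounded below by a positive
constant on `L(t−ε₀)`, and `q_h`, `D_x q_h`, `D_x² q_h` are uniformly bounded on
`L(t−ε₀) × ℝ^d`. -/
theorem stmt_5
    {d : ℕ}
    (t : ℝ) (ht : 0 < t)
    (f : Ed d → ℝ)
    (hfC2 : ContDiff ℝ 2 f) (hf0 : ∀ x, 0 ≤ f x)
    (hfbdd : ∃ M : ℝ, ∀ x, f x ≤ M ∧ ‖fderiv ℝ f x‖ ≤ M ∧ ‖fderiv ℝ (fderiv ℝ f) x‖ ≤ M)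
    (μ : Measure (Ed d)) [IsProbabilityMeasure μ]
    (hμ : μ = MeasureTheory.volume.withDensity (fun x => ENNReal.ofReal (f x)))
    (hcrit : ∀ x, f x = t → fderiv ℝ f x ≠ 0)
    (hrange : t ∈ interior (Set.range f))
    (hLtcomp : IsCompact {x | t ≤ f x})
    (h : ℝ) (hh : 0 < h)
    (k : Ed d → ℝ)
    (hkC2 : ContDiff ℝ 2 k) (hk0 : ∀ x, 0 ≤ k x)
    (hksupp : tsupport k = Metric.closedBall 0 1)
    (hklow : ∃ c > 0, ∀ x ∈ Metric.closedBall (0 : Ed d) (1 / 2), c ≤ k x)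
    (hksymm : ∀ x, k (-x) = k x)
    (ε0 : ℝ) (hε0 : 0 < ε0)
    (hstrip : ∀ x, t - ε0 ≤ f x → f x ≤ t + ε0 → fderiv ℝ f x ≠ 0)
    (α0 : ℝ) (hα0 : 0 < α0)
    (hα0le : ∀ x, t - ε0 ≤ f x → f x ≤ t → α0 ≤ ‖fderiv ℝ f x‖)
    (hε0h : ε0 / α0 < h / 2) :
    (∃ c > 0, ∀ x : Ed d, t - ε0 ≤ f x →
        c ≤ KH k h (ProbabilityTheory.cond μ {z | t ≤ f z}) x) ∧
    (∃ M : ℝ, ∀ x : Ed d, t - ε0 ≤ f x → ∀ y : Ed d,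
        qH k h (ProbabilityTheory.cond μ {z | t ≤ f z}) x y ≤ M) ∧
    (∃ M : ℝ, ∀ x : Ed d, t - ε0 ≤ f x → ∀ y : Ed d,
        ‖fderiv ℝ (fun x' => qH k h (ProbabilityTheory.cond μ {z | t ≤ f z}) x' y) x‖ ≤ M) ∧
    (∃ M : ℝ, ∀ x : Ed d, t - ε0 ≤ f x → ∀ y : Ed d,
        ‖fderiv ℝ (fun x'' =>
            fderiv ℝ (fun x' => qH k h (ProbabilityTheory.cond μ {z | t ≤ f z}) x' y) x'') x‖
          ≤ M) := by
  set ν := ProbabilityTheory.cond μ {z | t ≤ f z} with hνdef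
  have hfc := hfC2.continuous
  have hfd : Differentiable ℝ f := hfC2.differentiable (by norm_num)
  obtain ⟨r, hr1, hr2⟩ := exists_between hε0h
  have hmeas : MeasurableSet {z | t ≤ f z} := (isClosed_le continuous_const hfc).measurableSet
  have hreach := aux_reach hfd hε0 hα0 hα0le hr1
  set C : Set (Ed d) := {x | t - ε0 ≤ f x} with hCdef
  have hC : IsCompact C := by
    refine Metric.isCompact_of_isClosed_isBounded (isClosed_le continuous_const hfc) ?_
    refine (hLtcomp.isBounded.cthickening (δ := r)).subset fun x hx => ?_
    obtain ⟨z, hz, hzx⟩ := hreach x hx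
    exact mem_cthickening_of_dist_le x z r _ hz (by rwa [dist_comm])
  have hpos : ∀ x ∈ C, 0 < KH k h ν x := by
    intro x hx
    refine KH_pos hh hkC2 hk0 hksupp hklow ν x ?_
    obtain ⟨z, hz, hzx⟩ := hreach x hx
    have := aux_meas_pos ht hfc hcrit _ isOpen_ball z
      (mem_ball.2 (lt_of_le_of_lt hzx hr2)) hz
    rw [← hμ] at this
    rw [hνdef, ProbabilityTheory.cond_apply hmeas]
    exact ENNReal.mul_pos (ENNReal.inv_ne_zero.2 (measure_ne_top _ _)) this.ne'
  have hKC := KH_contDiff hh hkC2 hksupp hksymm ν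
  have hkC := kerh_contDiff (h := h) hkC2
  -- joint smoothness
  have hq : ∀ x ∈ C, ∀ y, ContDiffAt ℝ 2 (fun p : Ed d × Ed d => qH k h ν p.1 p.2) (x, y) := by
    intro x hx y
    unfold qH
    refine ContDiffAt.div ?_ ?_ (hpos x hx).ne'
    · exact (hkC.comp (contDiff_snd.sub contDiff_fst)).contDiffAt
    · exact (hKC.comp contDiff_fst).contDiffAt
  have hq1 : ∀ x ∈ C, ∀ y, ContDiffAt ℝ 1 (fun p : Ed d × Ed d =>
      fderiv ℝ (fun x' => qH k h ν x' p.2) p.1) (x, y) := by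
    intro x hx y
    refine ContDiffAt.fderiv (n := 2) (f := fun (p : Ed d × Ed d) x' => qH k h ν x' p.2)
      (g := fun p => p.1) ?_ contDiffAt_fst (by norm_num)
    exact ContDiffAt.comp (g := fun p : Ed d × Ed d => qH k h ν p.1 p.2)
      (f := fun p : (Ed d × Ed d) × Ed d => (p.2, p.1.2)) ((x, y), x) (hq x hx y)
      (contDiffAt_snd.prodMk (contDiffAt_snd.comp _ contDiffAt_fst))
  have hq2 : ∀ x ∈ C, ∀ y, ContDiffAt ℝ 0 (fun p : Ed d × Ed d =>
      fderiv ℝ (fun x'' => fderiv ℝ (fun x' => qH k h ν x' p.2) x'') p.1) (x, y) := by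
    intro x hx y
    refine ContDiffAt.fderiv (n := 1)
      (f := fun (p : Ed d × Ed d) x'' => fderiv ℝ (fun x' => qH k h ν x' p.2) x'')
      (g := fun p => p.1) ?_ contDiffAt_fst (by norm_num)
    exact ContDiffAt.comp
      (g := fun p : Ed d × Ed d => fderiv ℝ (fun x' => qH k h ν x' p.2) p.1)
      (f := fun p : (Ed d × Ed d) × Ed d => (p.2, p.1.2)) ((x, y), x) (hq1 x hx y)
      (contDiffAt_snd.prodMk (contDiffAt_snd.comp _ contDiffAt_fst))
  -- vanishing far away
  have hS : IsCompact (cthickening h C) := hC.cthickening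
  have hz : ∀ x ∈ C, ∀ y ∉ cthickening h C, (fun x' => qH k h ν x' y) =ᶠ[𝓝 x] fun _ => 0 := by
    intro x hx y hy
    have hxy : h < dist y x := by
      by_contra! hle
      exact hy (mem_cthickening_of_dist_le y x h C hx hle)
    have : ∀ᶠ x' in 𝓝 x, h < dist y x' :=
      (continuous_const.dist continuous_id).continuousAt.eventually (lt_mem_nhds hxy)
    filter_upwards [this] with x' hx'
    unfold qH
    rw [kerh_zero hh hksupp _ (by rwa [← dist_eq_norm]), zero_div]
  refine ⟨?_, ?_, ?_, ?_⟩
  · rcases C.eq_empty_or_nonempty with hE | hE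
    · exact ⟨1, one_pos, fun x hx => absurd (show x ∈ C from hx) (by simp [hE])⟩
    · obtain ⟨x0, hx0, hmin⟩ := hC.exists_isMinOn hE hKC.continuous.continuousOn
      exact ⟨_, hpos x0 hx0, fun x hx => hmin hx⟩
  · obtain ⟨M, hM⟩ := aux_bound hC _ hS (fun p : Ed d × Ed d => qH k h ν p.1 p.2)
      (fun x hx y => (hq x hx y).continuousAt) (fun x hx y hy => (hz x hx y hy).self_of_nhds)
    exact ⟨M, fun x hx y => (le_abs_self _).trans (hM x hx y)⟩
  · exact aux_bound hC _ hS (fun p : Ed d × Ed d => fderiv ℝ (fun x' => qH k h ν x' p.2) p.1)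
      (fun x hx y => (hq1 x hx y).continuousAt) (fun x hx y hy => by
        simpa using (hz x hx y hy).fderiv_eq)
  · exact aux_bound hC _ hS (fun p : Ed d × Ed d =>
      fderiv ℝ (fun x'' => fderiv ℝ (fun x' => qH k h ν x' p.2) x'') p.1)
      (fun x hx y => (hq2 x hx y).continuousAt) (fun x hx y hy => by
        have h1 := ((hz x hx y hy).fderiv (𝕜 := ℝ)).fderiv_eq (𝕜 := ℝ)
        simpa using h1)
end
end

section
/- There exists a sequence of diffeomorphisms φ_n : L(t) → L(t−ε_n) carrying L(t) onto L(t−ε_n) such that: (1) sup_{x ∈ L(t)} ‖φ_n(x) − x‖ → 0 as n → ∞, and (2) sup_{x ∈ L(t)} ‖D_x φ_n(x) − I_d‖ → 0 as n → ∞, where D_x φ_n denotes the differential of φ_n and I_d is the identity matrix on ℝ^d. -/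
open MeasureTheory Filter Set Metric
open scoped Topology

/-- Implicit function on an open set from monotonicity. -/
theorem aux_implicit {P : Type*} [NormedAddCommGroup P] [NormedSpace ℝ P] [CompleteSpace P]
    (G : P × ℝ → ℝ) (U : Set P) (hU : IsOpen U) (s0 : ℝ) (hs0 : 0 < s0)
    (hG : ∀ p ∈ U, ∀ s ∈ Icc (-s0) s0, ContDiffAt ℝ 1 G (p, s))
    (hd : ∀ p ∈ U, ∀ s ∈ Icc (-s0) s0, 0 < fderiv ℝ G (p, s) (0, 1))
    (hm : ∀ p ∈ U, G (p, -s0) < 0) (hp : ∀ p ∈ U, 0 < G (p, s0)) :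
    ∃ σ : P → ℝ, ∀ p ∈ U, σ p ∈ Ioo (-s0) s0 ∧ G (p, σ p) = 0 ∧ ContDiffAt ℝ 1 σ p ∧
      ∀ s ∈ Icc (-s0) s0, G (p, s) = 0 → s = σ p := by
  have hder : ∀ p ∈ U, ∀ s ∈ Icc (-s0) s0,
      HasDerivAt (fun s => G (p, s)) (fderiv ℝ G (p, s) (0, 1)) s := by
    intro p hpU s hs
    have h1 := ((hG p hpU s hs).differentiableAt one_ne_zero).hasFDerivAt
    exact h1.comp_hasDerivAt s ((hasDerivAt_const s p).prodMk (hasDerivAt_id s))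
  have hcont : ∀ p ∈ U, ContinuousOn (fun s => G (p, s)) (Icc (-s0) s0) := fun p hpU s hs =>
    (hder p hpU s hs).continuousAt.continuousWithinAt
  have hmono : ∀ p ∈ U, StrictMonoOn (fun s => G (p, s)) (Icc (-s0) s0) := by
    intro p hpU
    refine strictMonoOn_of_deriv_pos (convex_Icc _ _) (hcont p hpU) ?_
    intro s hs
    rw [(hder p hpU s (interior_subset hs)).deriv]
    exact hd p hpU s (interior_subset hs)
  have hex : ∀ p, ∃ s, p ∈ U → s ∈ Ioo (-s0) s0 ∧ G (p, s) = 0 := by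
    intro p
    by_cases hpU : p ∈ U
    · obtain ⟨s, hs, hs'⟩ := intermediate_value_Ioo (by linarith : -s0 ≤ s0) (hcont p hpU)
        ⟨hm p hpU, hp p hpU⟩
      exact ⟨s, fun _ => ⟨hs, hs'⟩⟩
    · exact ⟨0, fun h => absurd h hpU⟩
  choose σ hσ using hex
  have huniq : ∀ p ∈ U, ∀ s ∈ Icc (-s0) s0, G (p, s) = 0 → s = σ p := by
    intro p hpU s hs h
    exact (hmono p hpU).injOn hs (Ioo_subset_Icc_self (hσ p hpU).1) (h.trans (hσ p hpU).2.symm)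
  refine ⟨σ, fun p hpU => ⟨(hσ p hpU).1, (hσ p hpU).2, ?_, huniq p hpU⟩⟩
  have hs := (hσ p hpU).1
  have cdf := hG p hpU _ (Ioo_subset_Icc_self hs)
  have hinv : (fderiv ℝ G (p, σ p) ∘L .inr ℝ P ℝ).IsInvertible := by
    have h0 := (hd p hpU _ (Ioo_subset_Icc_self hs)).ne'
    refine ⟨ContinuousLinearEquiv.unitsEquivAut ℝ (Units.mk0 _ h0), ?_⟩
    ext
    simp
  have e1 := cdf.contDiffAt_implicitFunction one_ne_zero hinv
  refine e1.congr_of_eventuallyEq ?_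
  have e2 := cdf.eventually_apply_implicitFunction one_ne_zero hinv
  have e3 : ∀ᶠ q in 𝓝 p, cdf.implicitFunction one_ne_zero hinv q ∈ Ioo (-s0) s0 := by
    have := e1.continuousAt
    refine this.eventually_mem ?_
    rw [cdf.implicitFunction_apply_self one_ne_zero hinv]
    exact Ioo_mem_nhds hs.1 hs.2
  filter_upwards [e2, e3, hU.mem_nhds hpU] with q h2 h3 h4
  exact (huniq q h4 _ (Ioo_subset_Icc_self h3) (h2.trans (hσ p hpU).2)).symm

/-- Small C¹ perturbations of the identity are global diffeomorphisms. -/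
theorem aux_diffeo {E : Type*} [NormedAddCommGroup E] [NormedSpace ℝ E] [CompleteSpace E]
    (Φ : E → E) (hΦ : ContDiff ℝ 1 Φ)
    (h : ∀ x, ‖fderiv ℝ Φ x - ContinuousLinearMap.id ℝ E‖ ≤ 1 / 2) :
    ∃ Ψ : E → E, ContDiff ℝ 1 Ψ ∧ Function.LeftInverse Ψ Φ ∧ Function.RightInverse Ψ Φ := by
  have hdiff := hΦ.differentiable one_ne_zero
  rcases subsingleton_or_nontrivial E with hE | hE
  · exact ⟨id, contDiff_id, fun x => Subsingleton.elim _ _, fun x => Subsingleton.elim _ _⟩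
  have happ : ApproximatesLinearOn Φ ((ContinuousLinearEquiv.refl ℝ E : E ≃L[ℝ] E) : E →L[ℝ] E)
      univ (1/2 : NNReal) := by
    rw [ApproximatesLinearOn.approximatesLinearOn_iff_lipschitzOnWith, lipschitzOnWith_univ]
    refine lipschitzWith_of_nnnorm_fderiv_le (𝕜 := ℝ) ?_ ?_
    · exact hdiff.sub (ContinuousLinearMap.differentiable _)
    · intro x
      rw [fderiv_sub (hdiff x) (ContinuousLinearMap.differentiableAt _), ContinuousLinearMap.fderiv]
      exact h x
  have hc : (1/2 : NNReal) < ‖((ContinuousLinearEquiv.refl ℝ E).symm : E →L[ℝ] E)‖₊⁻¹ := by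
    have : ‖((ContinuousLinearEquiv.refl ℝ E).symm : E →L[ℝ] E)‖₊ = 1 :=
      ContinuousLinearMap.nnnorm_id
    rw [this]; norm_num
  let e := happ.toHomeomorph Φ (Or.inr hc)
  have he : (e : E → E) = Φ := rfl
  have hunit : ∀ x, ∃ L : E ≃L[ℝ] E, (L : E →L[ℝ] E) = fderiv ℝ Φ x := by
    intro x
    have h1 : IsUnit (1 - (1 - fderiv ℝ Φ x)) := by
      apply isUnit_one_sub_of_norm_lt_one
      rw [norm_sub_rev]
      exact lt_of_le_of_lt (h x) (by norm_num)
    rw [sub_sub_cancel] at h1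
    obtain ⟨u, hu⟩ := h1
    exact ⟨ContinuousLinearEquiv.unitsEquiv ℝ E u, by rw [← hu]; rfl⟩
  choose L hL using hunit
  refine ⟨e.symm, e.contDiff_symm (f₀' := L) ?_ hΦ, e.left_inv, e.right_inv⟩
  intro x
  rw [hL]
  exact (hdiff x).hasFDerivAt

/-- Uniform C¹ convergence to the identity. -/
theorem aux_tube {E : Type*} [NormedAddCommGroup E] [NormedSpace ℝ E]
    (Z : E × ℝ → E) (δ0 : ℝ) (hδ0 : 0 < δ0) (K : Set E) (hK : IsCompact K)
    (hZ : ∀ x, ∀ δ, |δ| < δ0 → ContDiffAt ℝ 1 Z (x, δ))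
    (h0 : ∀ x, Z (x, 0) = x) (hout : ∀ x ∉ K, ∀ δ, |δ| < δ0 → Z (x, δ) = x)
    (η : ℝ) (hη : 0 < η) :
    ∀ᶠ δ in 𝓝 (0 : ℝ), ∀ x, ‖Z (x, δ) - x‖ ≤ η ∧
      ‖fderiv ℝ (fun y => Z (y, δ)) x - ContinuousLinearMap.id ℝ E‖ ≤ η := by
  have hpart : ∀ x, ∀ δ, |δ| < δ0 → fderiv ℝ (fun y => Z (y, δ)) x =
      fderiv ℝ Z (x, δ) ∘L .inl ℝ E ℝ := by
    intro x δ hδ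
    have h1 := ((hZ x δ hδ).differentiableAt one_ne_zero).hasFDerivAt
    exact (h1.comp x (hasFDerivAt_prodMk_left x δ)).fderiv
  have hat : ∀ᶠ δ in 𝓝 (0 : ℝ), |δ| < δ0 := by
    have : ContinuousAt (fun δ : ℝ => |δ|) 0 := continuous_abs.continuousAt
    exact this.eventually_lt continuousAt_const (by simpa using hδ0)
  have hK' : ∀ᶠ δ in 𝓝 (0 : ℝ), ∀ x ∈ K, ‖Z (x, δ) - x‖ ≤ η ∧
      ‖fderiv ℝ Z (x, δ) ∘L .inl ℝ E ℝ - ContinuousLinearMap.id ℝ E‖ ≤ η := by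
    refine hK.eventually_forall_of_forall_eventually (P := fun δ x => ‖Z (x, δ) - x‖ ≤ η ∧
      ‖fderiv ℝ Z (x, δ) ∘L .inl ℝ E ℝ - ContinuousLinearMap.id ℝ E‖ ≤ η) ?_
    intro x hx
    have hsw : ContinuousAt (fun z : ℝ × E => (z.2, z.1)) (0, x) := by fun_prop
    have hc := hZ x 0 (by simpa using hδ0)
    have c1 : ContinuousAt (fun z : ℝ × E => ‖Z (z.2, z.1) - z.2‖) (0, x) := by
      have : ContinuousAt (fun z : ℝ × E => Z (z.2, z.1)) (0, x) :=
        ContinuousAt.comp (f := fun z : ℝ × E => (z.2, z.1)) (g := Z) hc.continuousAt hsw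
      exact (this.sub continuousAt_snd).norm
    have c2 : ContinuousAt (fun z : ℝ × E => ‖fderiv ℝ Z (z.2, z.1) ∘L .inl ℝ E ℝ -
        ContinuousLinearMap.id ℝ E‖) (0, x) := by
      have h1 : ContinuousAt (fderiv ℝ Z) (x, 0) :=
        (hc.fderiv_right (m := 0) (by norm_num)).continuousAt
      have : ContinuousAt (fun z : ℝ × E => fderiv ℝ Z (z.2, z.1)) (0, x) :=
        ContinuousAt.comp (f := fun z : ℝ × E => (z.2, z.1)) (g := fderiv ℝ Z) h1 hsw
      exact ((this.clm_comp continuousAt_const).sub continuousAt_const).norm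
    have e1 := c1.eventually_lt (continuousAt_const (y := η)) (by simpa [h0] using hη)
    have e2 := c2.eventually_lt (continuousAt_const (y := η)) (by
      have : fderiv ℝ Z (x, 0) ∘L .inl ℝ E ℝ = ContinuousLinearMap.id ℝ E := by
        rw [← hpart x 0 (by simpa using hδ0)]
        simp only [h0]
        exact fderiv_fun_id
      simpa [this] using hη)
    filter_upwards [e1, e2] with z h1 h2 using ⟨h1.le, h2.le⟩
  filter_upwards [hat, hK'] with δ hδ h x
  by_cases hx : x ∈ K
  · rw [hpart x δ hδ]; exact h x hx
  · refine ⟨by rw [hout x hx δ hδ]; simpa using hη.le, ?_⟩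
    have : (fun y => Z (y, δ)) =ᶠ[𝓝 x] id := by
      filter_upwards [hK.isClosed.isOpen_compl.mem_nhds hx] with y hy using hout y hy δ hδ
    rw [this.fderiv_eq, fderiv_id]
    simpa using hη.le

/-- A C¹ vector field along which `f` grows at unit speed. -/
theorem aux_field {E : Type*} [NormedAddCommGroup E] [InnerProductSpace ℝ E] [CompleteSpace E]
    (f : E → ℝ) (hf : ContDiff ℝ 2 f) :
    ∃ V : E → E, ∀ x, fderiv ℝ f x ≠ 0 → ContDiffAt ℝ 1 V x ∧ fderiv ℝ f x (V x) = 1 := by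
  let g : E → E := fun x => (InnerProductSpace.toDual ℝ E).symm (fderiv ℝ f x)
  have hg : ContDiff ℝ 1 g := by
    have h1 : ContDiff ℝ 1 (fderiv ℝ f) := hf.fderiv_right (by norm_num)
    exact (InnerProductSpace.toDual ℝ E).symm.contDiff.comp h1
  have hg0 : ∀ x, fderiv ℝ f x ≠ 0 → ‖g x‖ ^ 2 ≠ 0 := by
    intro x hx
    have : ‖g x‖ = ‖fderiv ℝ f x‖ := LinearIsometryEquiv.norm_map _ _
    rw [this]
    exact pow_ne_zero _ (norm_ne_zero_iff.2 hx)
  refine ⟨fun x => (‖g x‖ ^ 2)⁻¹ • g x, fun x hx => ⟨?_, ?_⟩⟩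
  · exact (((hg.norm_sq ℝ).contDiffAt).inv (hg0 x hx)).smul hg.contDiffAt
  · have : fderiv ℝ f x (g x) = ‖g x‖ ^ 2 := by
      rw [← real_inner_self_eq_norm_sq]
      exact (InnerProductSpace.toDual_symm_apply).symm
    rw [map_smul, this, smul_eq_mul, inv_mul_cancel₀ (hg0 x hx)]

/-- The one-step deformation. -/
theorem aux_core {E : Type*} [NormedAddCommGroup E] [InnerProductSpace ℝ E] [CompleteSpace E]
    (f : E → ℝ) (hf : ContDiff ℝ 2 f) (t ε0 r : ℝ) (hr : r < ε0)
    (hcomp : IsCompact (f ⁻¹' Icc (t - ε0) (t + ε0)))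
    (hnocrit : ∀ x ∈ f ⁻¹' Icc (t - ε0) (t + ε0), fderiv ℝ f x ≠ 0)
    (ρ : ℝ → ℝ) (hρ : ContDiff ℝ 1 ρ) (hρ1 : ∀ y, |ρ y| ≤ 1)
    (hρ0 : ∀ y, r ≤ |y - t| → ρ y = 0) :
    ∃ δ0 > 0, ∃ W : E × ℝ → E,
      (∀ x, ∀ δ, |δ| < δ0 → ContDiffAt ℝ 1 W (x, δ)) ∧
      (∀ x, W (x, 0) = x) ∧
      (∀ x ∉ f ⁻¹' Icc (t - ε0) (t + ε0), ∀ δ, |δ| < δ0 → W (x, δ) = x) ∧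
      (∀ x, ∀ δ, |δ| < δ0 → f (W (x, δ)) = f x - δ * ρ (f x)) := by
  classical
  obtain ⟨V, hV⟩ := aux_field f hf
  set K := f ⁻¹' Icc (t - ε0) (t + ε0) with hKdef
  have hf1 : ContDiff ℝ 1 f := hf.of_le (by norm_num)
  have hfd : Differentiable ℝ f := hf1.differentiable one_ne_zero
  have hfdc : Continuous (fderiv ℝ f) := hf1.continuous_fderiv one_ne_zero
  have htube : ∀ᶠ s in 𝓝 (0 : ℝ), ∀ x ∈ K, 1 / 2 < fderiv ℝ f (x - s • V x) (V x) := by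
    refine hcomp.eventually_forall_of_forall_eventually
      (P := fun s x => 1 / 2 < fderiv ℝ f (x - s • V x) (V x)) ?_
    intro x hx
    obtain ⟨hVc, hV1⟩ := hV x (hnocrit x hx)
    have hVc' : ContinuousAt (fun z : ℝ × E => V z.2) (0, x) :=
      ContinuousAt.comp (f := fun z : ℝ × E => z.2) (g := V) hVc.continuousAt continuousAt_snd
    have h1 : ContinuousAt (fun z : ℝ × E => z.2 - z.1 • V z.2) (0, x) :=
      continuousAt_snd.sub (continuousAt_fst.smul hVc')
    have h2 : ContinuousAt (fun z : ℝ × E => fderiv ℝ f (z.2 - z.1 • V z.2)) (0, x) :=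
      ContinuousAt.comp (f := fun z : ℝ × E => z.2 - z.1 • V z.2) (g := fderiv ℝ f)
        hfdc.continuousAt h1
    have h3 := h2.clm_apply hVc'
    refine (continuousAt_const (y := (1 / 2 : ℝ))).eventually_lt h3 ?_
    simp only [zero_smul, sub_zero, hV1]
    norm_num
  obtain ⟨e, he, hball⟩ := Metric.eventually_nhds_iff.1 htube
  obtain ⟨s0, hs0, hs0e⟩ : ∃ s0, 0 < s0 ∧ s0 < e := ⟨e / 2, by linarith, by linarith⟩
  have hH : ∀ x ∈ K, ∀ s ∈ Icc (-s0) s0, 1 / 2 < fderiv ℝ f (x - s • V x) (V x) := by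
    intro x hx s hs
    refine hball ?_ x hx
    rw [Real.dist_eq, sub_zero]
    exact lt_of_le_of_lt (abs_le.2 hs) hs0e
  clear hball htube
  let U' : Set E := f ⁻¹' Ioo (t - ε0) (t + ε0)
  have hU' : IsOpen U' := isOpen_Ioo.preimage hf1.continuous
  have hU'K : U' ⊆ K := preimage_mono Ioo_subset_Icc_self
  let G : (E × ℝ) × ℝ → ℝ := fun q => f q.1.1 - f (q.1.1 - q.2 • V q.1.1) - q.1.2 * ρ (f q.1.1)
  have hGc : ∀ x ∈ K, ∀ δ s, ContDiffAt ℝ 1 G ((x, δ), s) := by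
    intro x hx δ s
    have hVc := (hV x (hnocrit x hx)).1
    have a1 : ContDiffAt ℝ 1 (fun q : (E × ℝ) × ℝ => q.1.1) ((x, δ), s) := by fun_prop
    have a2 : ContDiffAt ℝ 1 (fun q : (E × ℝ) × ℝ => V q.1.1) ((x, δ), s) :=
      ContDiffAt.comp (f := fun q : (E × ℝ) × ℝ => q.1.1) (g := V) _ hVc a1
    have a3 : ContDiffAt ℝ 1 (fun q : (E × ℝ) × ℝ => q.1.1 - q.2 • V q.1.1) ((x, δ), s) :=
      a1.sub (contDiffAt_snd.smul a2)
    have a4 := hf1.contDiffAt.comp _ a3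
    have a5 := hf1.contDiffAt.comp _ a1
    have a6 := hρ.contDiffAt.comp _ a5
    have a7 : ContDiffAt ℝ 1 (fun q : (E × ℝ) × ℝ => q.1.2) ((x, δ), s) := by fun_prop
    exact (a5.sub a4).sub (a7.mul a6)
  have hGd : ∀ x δ s, HasDerivAt (fun s => G ((x, δ), s)) (fderiv ℝ f (x - s • V x) (V x)) s := by
    intro x δ s
    have b1 : HasDerivAt (fun s : ℝ => x - s • V x) (-(V x)) s := by
      simpa using ((hasDerivAt_id s).smul_const (V x)).const_sub x
    have b2 := (hfd (x - s • V x)).hasFDerivAt.comp_hasDerivAt s b1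
    have b3 := (b2.const_sub (f x)).sub_const (δ * ρ (f x))
    rw [map_neg, neg_neg] at b3
    exact b3
  have hGd' : ∀ x ∈ K, ∀ δ s, fderiv ℝ G ((x, δ), s) (0, 1) = fderiv ℝ f (x - s • V x) (V x) := by
    intro x hx δ s
    have h1 := ((hGc x hx δ s).differentiableAt one_ne_zero).hasFDerivAt
    have h2 := h1.comp_hasDerivAt s ((hasDerivAt_const s (x, δ)).prodMk (hasDerivAt_id s))
    exact h2.unique (hGd x δ s)
  have hGmv : ∀ x ∈ K, ∀ δ, ∀ a ∈ Icc (-s0) s0, ∀ b ∈ Icc (-s0) s0, a ≤ b →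
      1 / 2 * (b - a) ≤ G ((x, δ), b) - G ((x, δ), a) := by
    intro x hx δ a ha b hb hab
    refine (convex_Icc (-s0) s0).mul_sub_le_image_sub_of_le_deriv
      (f := fun s => G ((x, δ), s)) ?_ ?_ ?_ a ha b hb hab
    · exact fun s _ => (hGd x δ s).continuousAt.continuousWithinAt
    · exact fun s _ => (hGd x δ s).differentiableAt.differentiableWithinAt
    · intro s hs
      rw [(hGd x δ s).deriv]
      exact (hH x hx s (interior_subset hs)).le
  have hG0 : ∀ x δ, G ((x, δ), 0) = -(δ * ρ (f x)) := by
    intro x δ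
    simp [G]
  have hsmall : ∀ x δ, |δ| < s0 / 2 → |δ * ρ (f x)| < s0 / 2 := by
    intro x δ hδ
    rw [abs_mul]
    exact lt_of_le_of_lt (mul_le_of_le_one_right (abs_nonneg _) (hρ1 _)) hδ
  let U : Set (E × ℝ) := U' ×ˢ ball 0 (s0 / 2)
  have hUmem : ∀ x ∈ U', ∀ δ, |δ| < s0 / 2 → (x, δ) ∈ U := by
    intro x hx δ hδ
    exact ⟨hx, by simpa using hδ⟩
  obtain ⟨σ, hσ⟩ := aux_implicit G U (hU'.prod isOpen_ball) s0 hs0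
    (fun p hp s _ => hGc p.1 (hU'K hp.1) p.2 s)
    (fun p hp s hs => by
      have := hGd' p.1 (hU'K hp.1) p.2 s
      have h2 := hH p.1 (hU'K hp.1) s hs
      change 0 < fderiv ℝ G ((p.1, p.2), s) (0, 1)
      rw [this]; linarith)
    (fun p hp => by
      have h1 := hGmv p.1 (hU'K hp.1) p.2 (-s0) ⟨le_rfl, by linarith⟩ 0
        ⟨by linarith, by linarith⟩ (by linarith)
      have h2 := abs_lt.1 (hsmall p.1 p.2 (by simpa using hp.2))
      rw [hG0] at h1
      change G ((p.1, p.2), -s0) < 0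
      linarith [h2.1, h2.2])
    (fun p hp => by
      have h1 := hGmv p.1 (hU'K hp.1) p.2 0 ⟨by linarith, by linarith⟩ s0
        ⟨by linarith, by linarith⟩ (by linarith)
      have h2 := abs_lt.1 (hsmall p.1 p.2 (by simpa using hp.2))
      rw [hG0] at h1
      change 0 < G ((p.1, p.2), s0)
      linarith [h2.1, h2.2])
  have hσ0 : ∀ x ∈ U', ∀ δ, |δ| < s0 / 2 → δ * ρ (f x) = 0 → σ (x, δ) = 0 := by
    intro x hx δ hδ h
    refine ((hσ (x, δ) (hUmem x hx δ hδ)).2.2.2 0 ⟨by linarith, by linarith⟩ ?_).symm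
    rw [hG0, h, neg_zero]
  let W : E × ℝ → E := fun p => if p.1 ∈ U' then p.1 - σ p • V p.1 else p.1
  have hWin : ∀ x ∈ U', ∀ δ, W (x, δ) = x - σ (x, δ) • V x := fun x hx δ => if_pos hx
  have hWout : ∀ x ∉ U', ∀ δ, W (x, δ) = x := fun x hx δ => if_neg hx
  have hWρ : ∀ x δ, |δ| < s0 / 2 → δ * ρ (f x) = 0 → W (x, δ) = x := by
    intro x δ hδ h
    by_cases hx : x ∈ U'
    · rw [hWin x hx, hσ0 x hx δ hδ h, zero_smul, sub_zero]
    · exact hWout x hx δ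
  have hout0 : ∀ x ∉ U', r < |f x - t| := by
    intro x hx
    by_contra hcon
    have := abs_le.1 (not_lt.1 hcon)
    exact hx ⟨by linarith [this.1], by linarith [this.2]⟩
  refine ⟨s0 / 2, by linarith, W, ?_, ?_, ?_, ?_⟩
  · intro x δ hδ
    by_cases hx : x ∈ U'
    · have hVc := (hV x (hnocrit x (hU'K hx))).1
      have c1 := (hσ (x, δ) (hUmem x hx δ hδ)).2.2.1
      have c2 : ContDiffAt ℝ 1 (fun q : E × ℝ => V q.1) (x, δ) :=
        ContDiffAt.comp (f := fun q : E × ℝ => q.1) (g := V) _ hVc contDiffAt_fst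
      have c3 : ContDiffAt ℝ 1 (fun q : E × ℝ => q.1 - σ q • V q.1) (x, δ) :=
        contDiffAt_fst.sub (c1.smul c2)
      refine c3.congr_of_eventuallyEq ?_
      filter_upwards [continuousAt_fst.eventually_mem (hU'.mem_nhds hx)] with q hq
      exact hWin q.1 hq q.2
    · refine (contDiffAt_fst (𝕜 := ℝ) (n := 1) (p := (x, δ))).congr_of_eventuallyEq ?_
      have n1 : ∀ᶠ q : E × ℝ in 𝓝 (x, δ), r < |f q.1 - t| := by
        have : Continuous (fun q : E × ℝ => |f q.1 - t|) :=
          ((hf1.continuous.comp continuous_fst).sub continuous_const).abs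
        exact continuousAt_const.eventually_lt this.continuousAt (hout0 x hx)
      have n2 : ∀ᶠ q : E × ℝ in 𝓝 (x, δ), |q.2| < s0 / 2 := by
        have : Continuous (fun q : E × ℝ => |q.2|) := continuous_snd.abs
        exact this.continuousAt.eventually_lt continuousAt_const hδ
      filter_upwards [n1, n2] with q h1 h2
      exact hWρ q.1 q.2 h2 (by rw [hρ0 _ h1.le, mul_zero])
  · intro x
    exact hWρ x 0 (by simpa using hs0) (zero_mul _)
  · intro x hx δ _
    exact hWout x (fun h => hx (hU'K h)) δ
  · intro x δ hδ
    by_cases hx : x ∈ U'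
    · have := (hσ (x, δ) (hUmem x hx δ hδ)).2.1
      rw [hWin x hx]
      simp only [G] at this
      linarith
    · rw [hWout x hx, hρ0 _ (hout0 x hx).le, mul_zero, sub_zero]

/-- (Lemma on the geometry of level sets.)  If the strip
`f⁻¹([t−ε₀, t+ε₀])` is nonempty, compact and contains no critical point of the `C²`
function `f`, and `εₙ ∈ (0, ε₀)` with `εₙ → 0`, then there exists a sequence of
diffeomorphisms `φₙ` carrying `L(t)` onto `L(t−εₙ)` such that
`sup_{x∈L(t)} ‖φₙ(x) − x‖ → 0` and `sup_{x∈L(t)} ‖Dφₙ(x) − I_d‖ → 0`. -/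
theorem stmt_10
    {d : ℕ}
    (f : EuclideanSpace ℝ (Fin d) → ℝ)
    (hf : ContDiff ℝ 2 f)
    (t ε0 : ℝ)
    (hne : (f ⁻¹' Icc (t - ε0) (t + ε0)).Nonempty)
    (hcomp : IsCompact (f ⁻¹' Icc (t - ε0) (t + ε0)))
    (hnocrit : ∀ x ∈ f ⁻¹' Icc (t - ε0) (t + ε0), fderiv ℝ f x ≠ 0)
    (ε : ℕ → ℝ) (hεpos : ∀ n, 0 < ε n) (hεlt : ∀ n, ε n < ε0)
    (hεlim : Tendsto ε atTop (𝓝 0)) :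
    ∃ φ ψ : ℕ → EuclideanSpace ℝ (Fin d) → EuclideanSpace ℝ (Fin d),
      (∀ n, ContDiff ℝ 1 (φ n)) ∧
      (∀ n, ContDiff ℝ 1 (ψ n)) ∧
      (∀ n, Set.BijOn (φ n) {x | t ≤ f x} {x | t - ε n ≤ f x}) ∧
      (∀ n, ∀ x ∈ {x | t ≤ f x}, ψ n (φ n x) = x) ∧
      (∀ n, ∀ y ∈ {x | t - ε n ≤ f x}, φ n (ψ n y) = y) ∧
      Tendsto (fun n => ⨆ x : {x | t ≤ f x}, ‖φ n x - (x : EuclideanSpace ℝ (Fin d))‖)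
        atTop (𝓝 0) ∧
      Tendsto (fun n => ⨆ x : {x | t ≤ f x},
          ‖fderiv ℝ (φ n) x - ContinuousLinearMap.id ℝ (EuclideanSpace ℝ (Fin d))‖)
        atTop (𝓝 0) := by
  -- a uniform bound on the shifts
  obtain ⟨ε', hε'0, hε', hεle⟩ : ∃ ε', 0 < ε' ∧ ε' < ε0 ∧ ∀ n, ε n ≤ ε' := by
    have hc : IsCompact (insert 0 (range ε)) := hεlim.isCompact_insert_range
    obtain ⟨m, hm, hmax⟩ := hc.exists_isMaxOn ⟨0, mem_insert _ _⟩ continuousOn_id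
    have hle : ∀ n, ε n ≤ m := fun n => hmax (mem_insert_of_mem _ (mem_range_self n))
    refine ⟨m, lt_of_lt_of_le (hεpos 0) (hle 0), ?_, hle⟩
    rcases hm with rfl | ⟨n, rfl⟩
    · exact (hεpos 0).trans (hεlt 0)
    · exact hεlt n
  -- the cutoff
  let β : ContDiffBump t := ⟨ε', (ε' + ε0) / 2, hε'0, by linarith⟩
  have hβ1 : ∀ y, |β y| ≤ 1 := fun y => by
    rw [abs_of_nonneg β.nonneg]; exact β.le_one
  have hβ0 : ∀ y, (ε' + ε0) / 2 ≤ |y - t| → β y = 0 := fun y hy =>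
    β.zero_of_le_dist (by rwa [Real.dist_eq])
  have hβone : ∀ y, |y - t| ≤ ε' → β y = 1 := fun y hy =>
    β.one_of_mem_closedBall (by rwa [mem_closedBall, Real.dist_eq])
  have hβc : ContDiff ℝ 1 β := β.contDiff
  obtain ⟨C, hC⟩ := hβc.lipschitzWith_of_hasCompactSupport β.hasCompactSupport one_ne_zero
  obtain ⟨δ0, hδ0, W, hWc, hW0, hWout, hWf⟩ :=
    aux_core f hf t ε0 ((ε' + ε0) / 2) (by linarith) hcomp hnocrit β hβc hβ1 hβ0
  set K := f ⁻¹' Icc (t - ε0) (t + ε0) with hK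
  -- choose the size of a step
  have hmono : ∀ᶠ δ in 𝓝 (0 : ℝ), |δ| * (C : ℝ) < 1 := by
    have : Continuous (fun δ : ℝ => |δ| * (C : ℝ)) := by fun_prop
    exact this.continuousAt.eventually_lt continuousAt_const (by simp)
  obtain ⟨δ1, hδ1, hδ1'⟩ := Metric.eventually_nhds_iff.1
    ((aux_tube W δ0 hδ0 K hcomp hWc hW0 hWout (1 / 2) (by norm_num)).and hmono)
  obtain ⟨N, hN⟩ := exists_nat_gt (ε0 / min δ0 δ1)
  have hmin : 0 < min δ0 δ1 := lt_min hδ0 hδ1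
  have hε0 : 0 < ε0 := hε'0.trans hε'
  have hNpos : (0 : ℝ) < N := lt_trans (div_pos hε0 hmin) hN
  have hstep : ∀ n, ε n / N < min δ0 δ1 := by
    intro n
    rw [div_lt_iff₀ hNpos]
    rw [div_lt_iff₀ hmin] at hN
    nlinarith [hεlt n]
  have hsteppos : ∀ n, 0 < ε n / N := fun n => div_pos (hεpos n) hNpos
  have habs0 : ∀ n, |ε n / N| < δ0 := fun n => by
    rw [abs_of_pos (hsteppos n)]; exact (hstep n).trans_le (min_le_left _ _)
  have habs1 : ∀ n, dist (ε n / N) 0 < δ1 := fun n => by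
    rw [Real.dist_eq, sub_zero, abs_of_pos (hsteppos n)]
    exact (hstep n).trans_le (min_le_right _ _)
  have hΦc : ∀ n, ContDiff ℝ 1 (fun x => W (x, ε n / N)) := fun n =>
    contDiff_iff_contDiffAt.2 fun x =>
      ContDiffAt.comp (f := fun y => (y, ε n / N)) (g := W) x (hWc x _ (habs0 n))
        (contDiffAt_id.prodMk contDiffAt_const)
  have hinv := fun n => aux_diffeo (fun x => W (x, ε n / N)) (hΦc n)
    (fun x => ((hδ1' (habs1 n)).1 x).2)
  choose Ψ hΨc hΨl hΨr using hinv
  -- the iterated deformation as a joint map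
  let Z : ℕ → EuclideanSpace ℝ (Fin d) × ℝ → EuclideanSpace ℝ (Fin d) :=
    fun m p => (fun x => W (x, p.2))^[m] p.1
  have hZs : ∀ m p, Z (m + 1) p = W (Z m p, p.2) := fun m p =>
    Function.iterate_succ_apply' _ _ _
  have hZc : ∀ m, ∀ x, ∀ δ, |δ| < δ0 → ContDiffAt ℝ 1 (Z m) (x, δ) := by
    intro m
    induction m with
    | zero => intro x δ _; exact contDiffAt_fst
    | succ m ih =>
      intro x δ hδ
      have : Z (m + 1) = fun p => W (Z m p, p.2) := funext (hZs m)
      rw [this]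
      exact ContDiffAt.comp (f := fun p => (Z m p, p.2)) (g := W) (x, δ) (hWc _ δ hδ)
        ((ih x δ hδ).prodMk contDiffAt_snd)
  have hZ0 : ∀ m x, Z m (x, 0) = x := fun m x => Function.iterate_fixed (hW0 x) m
  have hZout : ∀ m, ∀ x ∉ K, ∀ δ, |δ| < δ0 → Z m (x, δ) = x := fun m x hx δ hδ =>
    Function.iterate_fixed (hWout x hx δ hδ) m
  have htube := fun η hη => aux_tube (Z N) δ0 hδ0 K hcomp (hZc N) (hZ0 N) (hZout N) η hη
  have hlim : Tendsto (fun n => ε n / N) atTop (𝓝 0) := by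
    simpa using hεlim.div_const (N : ℝ)
  -- level sets
  have hg : ∀ n, StrictMono (fun y : ℝ => y - ε n / N * β y) := by
    intro n a b hab
    have h1 := hC.dist_le_mul a b
    have h2 := (hδ1' (habs1 n)).2
    rw [Real.dist_eq, Real.dist_eq, abs_sub_comm a b, abs_of_pos (sub_pos.2 hab),
      abs_sub_comm] at h1
    rw [abs_of_pos (hsteppos n)] at h2
    have h3 := (le_abs_self _).trans h1
    have h4 := mul_le_mul_of_nonneg_left h3 (hsteppos n).le
    have h5 := mul_lt_mul_of_pos_right h2 (sub_pos.2 hab)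
    change a - ε n / N * β a < b - ε n / N * β b
    nlinarith
  have hfZ : ∀ n m x, f (Z m (x, ε n / N)) = (fun y : ℝ => y - ε n / N * β y)^[m] (f x) := by
    intro n m x
    induction m with
    | zero => rfl
    | succ m ih => rw [hZs, hWf _ _ (habs0 n), ih, Function.iterate_succ_apply']
  have hgt : ∀ n, ∀ m ≤ N, (fun y : ℝ => y - ε n / N * β y)^[m] t = t - m * (ε n / N) := by
    intro n m
    induction m with
    | zero => intro _; simp
    | succ m ih =>
      intro hm
      rw [Function.iterate_succ_apply', ih (by omega)]
      have hm' : (m : ℝ) ≤ N := by exact_mod_cast (by omega : m ≤ N)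
      have h1 : (m : ℝ) * (ε n / N) ≤ ε n := by
        calc (m : ℝ) * (ε n / N) ≤ N * (ε n / N) :=
              mul_le_mul_of_nonneg_right hm' (hsteppos n).le
          _ = ε n := by field_simp
      have h2 : 0 ≤ (m : ℝ) * (ε n / N) := mul_nonneg (Nat.cast_nonneg _) (hsteppos n).le
      have : β (t - m * (ε n / N)) = 1 := hβone _ (by
        rw [sub_sub_cancel_left, abs_neg, abs_of_nonneg h2]
        exact h1.trans (hεle n))
      simp only [this]
      push_cast
      ring
  have hlevel : ∀ n x, t - ε n ≤ f (Z N (x, ε n / N)) ↔ t ≤ f x := by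
    intro n x
    have h1 := hgt n N le_rfl
    have h2 : (N : ℝ) * (ε n / N) = ε n := by field_simp
    rw [h2] at h1
    rw [hfZ, ← h1]
    exact ((hg n).iterate N).le_iff_le
  have hl : ∀ n, Function.LeftInverse ((Ψ n)^[N]) (fun x => Z N (x, ε n / N)) := fun n =>
    (hΨl n).iterate N
  have hr : ∀ n, Function.RightInverse ((Ψ n)^[N]) (fun x => Z N (x, ε n / N)) := fun n =>
    (hΨr n).iterate N
  have hsup : ∀ η > 0, ∀ᶠ n in atTop, ∀ x, ‖Z N (x, ε n / N) - x‖ ≤ η ∧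
      ‖fderiv ℝ (fun y => Z N (y, ε n / N)) x -
        ContinuousLinearMap.id ℝ (EuclideanSpace ℝ (Fin d))‖ ≤ η := fun η hη =>
    hlim.eventually (htube η hη)
  refine ⟨fun n x => Z N (x, ε n / N), fun n => (Ψ n)^[N], ?_, ?_, ?_, ?_, ?_, ?_, ?_⟩
  · intro n
    exact contDiff_iff_contDiffAt.2 fun x =>
      ContDiffAt.comp (f := fun y => (y, ε n / N)) (g := Z N) x (hZc N x _ (habs0 n))
        (contDiffAt_id.prodMk contDiffAt_const)
  · intro n
    have : ∀ m, ContDiff ℝ 1 ((Ψ n)^[m]) := by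
      intro m
      induction m with
      | zero => exact contDiff_id
      | succ m ih => rw [Function.iterate_succ']; exact (hΨc n).comp ih
    exact this N
  · intro n
    refine ⟨fun x hx => (hlevel n x).2 hx, (hl n).injective.injOn, ?_⟩
    intro y hy
    refine ⟨(Ψ n)^[N] y, ?_, hr n y⟩
    have := hlevel n ((Ψ n)^[N] y)
    rw [show Z N ((Ψ n)^[N] y, ε n / N) = y from hr n y] at this
    exact this.1 hy
  · intro n x _
    exact hl n x
  · intro n y _
    exact hr n y
  · rw [Metric.tendsto_atTop']
    intro η hη
    obtain ⟨n0, hn0⟩ := eventually_atTop.1 (hsup (η / 2) (by linarith))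
    refine ⟨n0, fun n hn => ?_⟩
    rw [Real.dist_eq, sub_zero, abs_of_nonneg (Real.iSup_nonneg fun _ => norm_nonneg _)]
    refine lt_of_le_of_lt (Real.iSup_le (fun x => (hn0 n hn.le x).1) (by linarith)) (by linarith)
  · rw [Metric.tendsto_atTop']
    intro η hη
    obtain ⟨n0, hn0⟩ := eventually_atTop.1 (hsup (η / 2) (by linarith))
    refine ⟨n0, fun n hn => ?_⟩
    rw [Real.dist_eq, sub_zero, abs_of_nonneg (Real.iSup_nonneg fun _ => norm_nonneg _)]
    refine lt_of_le_of_lt (Real.iSup_le (fun x => (hn0 n hn.le x).2) (by linarith)) (by linarith)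
end

section
/- For every x ∈ ℝ^d with t − ε0 ≤ f(x) ≤ t, the distance from x to the level set L(t) satisfies dist(x, L(t)) ≤ ε0/β, where β := inf{ ‖D_x f(y)‖ : y ∈ f^{−1}([t−ε0, t+ε0]) } > 0. -/
open MeasureTheory Filter Set Metric
open scoped Topology

/-- If the strip `f⁻¹([t−ε₀, t+ε₀])` is nonempty, compact and contains
no critical point of the `C²` function `f`, then, with
`β := inf{‖Df(y)‖ : y ∈ f⁻¹([t−ε₀, t+ε₀])} > 0`, every point `x` with
`t − ε₀ ≤ f x ≤ t` satisfies `dist(x, L(t)) ≤ ε₀ / β`. -/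
theorem stmt_11
    {d : ℕ}
    (f : EuclideanSpace ℝ (Fin d) → ℝ)
    (hf : ContDiff ℝ 2 f)
    (t ε0 : ℝ) (hε0 : 0 < ε0)
    (hne : (f ⁻¹' Icc (t - ε0) (t + ε0)).Nonempty)
    (hcomp : IsCompact (f ⁻¹' Icc (t - ε0) (t + ε0)))
    (hnocrit : ∀ x ∈ f ⁻¹' Icc (t - ε0) (t + ε0), fderiv ℝ f x ≠ 0) :
    0 < sInf ((fun y => ‖fderiv ℝ f y‖) '' (f ⁻¹' Icc (t - ε0) (t + ε0))) ∧
    ∀ x : EuclideanSpace ℝ (Fin d), t - ε0 ≤ f x → f x ≤ t →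
      infDist x {y | t ≤ f y} ≤
        ε0 / sInf ((fun y => ‖fderiv ℝ f y‖) '' (f ⁻¹' Icc (t - ε0) (t + ε0))) := by
  set K := f ⁻¹' Icc (t - ε0) (t + ε0) with hK
  have hcf : Continuous f := hf.continuous
  have hcd : Continuous (fderiv ℝ f) := hf.continuous_fderiv (by norm_num)
  have hcn : Continuous (fun y => ‖fderiv ℝ f y‖) := hcd.norm
  have hcK : IsCompact ((fun y => ‖fderiv ℝ f y‖) '' K) := hcomp.image hcn
  have hpos : 0 < sInf ((fun y => ‖fderiv ℝ f y‖) '' K) := by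
    obtain ⟨y, hy, hyeq⟩ := hcK.sInf_mem (hne.image _)
    rw [← hyeq]
    exact norm_pos_iff.mpr (hnocrit y hy)
  have hle : ∀ y ∈ K, sInf ((fun y => ‖fderiv ℝ f y‖) '' K) ≤ ‖fderiv ℝ f y‖ :=
    fun y hy => csInf_le hcK.bddBelow (mem_image_of_mem _ hy)
  refine ⟨hpos, ?_⟩
  generalize sInf ((fun y => ‖fderiv ℝ f y‖) '' K) = β at hpos hle ⊢
  intro x hx1 hx2
  have key : ∀ b, 0 < b → b < β → infDist x {y | t ≤ f y} ≤ ε0 / b := by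
    intro b hb hbβ
    have hK' : IsCompact (K ∩ f ⁻¹' Iic t) := hcomp.inter_right (isClosed_Iic.preimage hcf)
    have hxK : x ∈ K ∩ f ⁻¹' Iic t := ⟨⟨hx1, by linarith⟩, hx2⟩
    obtain ⟨y, ⟨hyK, hyt⟩, hmax⟩ := hK'.exists_isMaxOn ⟨x, hxK⟩
      (f := fun y => f y - b * dist x y) (by fun_prop)
    have hyt' : f y ≤ t := hyt
    have hyeq : f y = t := by
      by_contra hneq
      have hlt : f y < t := lt_of_le_of_ne hyt' hneq
      obtain ⟨v, hv⟩ : ∃ v, b * ‖v‖ < fderiv ℝ f y v := by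
        by_contra! hcon
        have : ‖fderiv ℝ f y‖ ≤ b := by
          refine ContinuousLinearMap.opNorm_le_bound _ hb.le fun v => ?_
          rw [Real.norm_eq_abs, abs_le]
          have h1 := hcon v
          have h2 := hcon (-v)
          rw [map_neg, norm_neg] at h2
          constructor <;> linarith
        linarith [hle y hyK]
      have hd : HasDerivAt (fun s : ℝ => f (y + s • v)) (fderiv ℝ f y v) 0 := by
        have h1 : HasFDerivAt f (fderiv ℝ f y) (y + (0:ℝ) • v) := by
          simpa using (hf.differentiable (by norm_num) y).hasFDerivAt
        have h2 : HasDerivAt (fun s : ℝ => y + s • v) v 0 := by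
          simpa using ((hasDerivAt_id (0:ℝ)).smul_const v).const_add y
        exact h1.comp_hasDerivAt 0 h2
      have hs := (hasDerivAt_iff_tendsto_slope.mp hd).eventually_const_lt hv
      have hs' : ∀ᶠ s in 𝓝[>] (0:ℝ), b * ‖v‖ < slope (fun s : ℝ => f (y + s • v)) 0 s :=
        hs.filter_mono (nhdsWithin_mono _ fun s hs => ne_of_gt hs)
      have hc : ∀ᶠ s in 𝓝[>] (0:ℝ), f (y + s • v) < t := by
        apply Filter.Eventually.filter_mono nhdsWithin_le_nhds
        have : Continuous fun s : ℝ => f (y + s • v) := by fun_prop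
        exact this.continuousAt.eventually_lt continuousAt_const (by simpa using hlt)
      obtain ⟨s, ⟨hs1, hs2⟩, hs0⟩ := ((hs'.and hc).and self_mem_nhdsWithin).exists
      have hs0 : 0 < s := hs0
      rw [slope_def_field, zero_smul, add_zero, sub_zero, lt_div_iff₀ hs0] at hs1
      have hnn : 0 ≤ b * ‖v‖ * s := by positivity
      have hm := hmax (show y + s • v ∈ K ∩ f ⁻¹' Iic t from
        ⟨⟨by linarith [hyK.1], by linarith⟩, hs2.le⟩)
      simp only [mem_setOf_eq] at hm
      have htri : dist x (y + s • v) ≤ dist x y + s * ‖v‖ := by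
        refine (dist_triangle x y _).trans ?_
        rw [dist_self_add_right, norm_smul, Real.norm_of_nonneg hs0.le]
      have := mul_le_mul_of_nonneg_left htri hb.le
      nlinarith
    have hm := hmax hxK
    simp only [mem_setOf_eq, dist_self] at hm
    refine (infDist_le_dist_of_mem (show y ∈ {y | t ≤ f y} from hyeq.ge)).trans ?_
    rw [le_div_iff₀ hb]
    linarith
  rw [le_div_iff₀ hpos]
  have hlim : Tendsto (fun b => infDist x {y | t ≤ f y} * b) (𝓝[<] β)
      (𝓝 (infDist x {y | t ≤ f y} * β)) :=
    ((continuous_const.mul continuous_id).tendsto β).mono_left nhdsWithin_le_nhds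
  refine le_of_tendsto hlim ?_
  filter_upwards [Ioo_mem_nhdsLT hpos] with b hb
  exact (le_div_iff₀ hb.1).mp (key b hb.1 hb.2)
end

section
/- If g : L(t) → ℝ is continuous and satisfies Q_h g = g, then g is constant on each connected component of L(t); consequently, the eigenspace of Q_h associated with the eigenvalue 1 is spanned by the indicator functions 1_{C_1},…,1_{C_ℓ} of the connected components of L(t), and in particular 1 is an eigenvalue of Q_h of multiplicity ℓ. -/
open MeasureTheory ProbabilityTheory Filter Set Metric
open scoped Topology Classical ENNReal

noncomputable section

theorem aux_pos {d : ℕ} (t : ℝ) (ht : 0 < t) (f : Ed d → ℝ) (hfC2 : ContDiff ℝ 2 f)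
    (μ : Measure (Ed d)) [IsProbabilityMeasure μ]
    (hμ : μ = MeasureTheory.volume.withDensity (fun x => ENNReal.ofReal (f x)))
    (hcrit : ∀ x, f x = t → fderiv ℝ f x ≠ 0) (x : Ed d) (hx : t ≤ f x)
    (U : Set (Ed d)) (hU : U ∈ 𝓝 x) : μ ({z | t ≤ f z} ∩ U) ≠ 0 := by
  have hfc : Continuous f := hfC2.continuous
  have hne : ∃ y ∈ interior U, t < f y := by
    by_contra! hcon
    have hxU : x ∈ interior U := mem_interior_iff_mem_nhds.mpr hU
    have hxt : f x = t := le_antisymm (hcon x hxU) hx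
    have hloc : IsLocalMax f x := by
      filter_upwards [isOpen_interior.mem_nhds hxU] with y hy
      rw [hxt]; exact hcon y hy
    exact hcrit x hxt hloc.fderiv_eq_zero
  obtain ⟨y, hyU, hyt⟩ := hne
  have hVo : IsOpen (interior U ∩ {z | t < f z}) :=
    isOpen_interior.inter (isOpen_lt continuous_const hfc)
  have hVpos : volume (interior U ∩ {z | t < f z}) ≠ 0 :=
    (hVo.measure_pos volume ⟨y, hyU, hyt⟩).ne'
  intro h0
  have h1 : μ (interior U ∩ {z | t < f z}) = 0 :=
    by
    refine measure_mono_null ?_ h0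
    rintro z ⟨hz1, hz2⟩
    have hz3 : t < f z := hz2
    have hz4 : t ≤ f z := hz3.le
    exact ⟨by simpa using hz4, interior_subset hz1⟩
  rw [hμ, withDensity_apply_eq_zero (by fun_prop)] at h1
  apply hVpos
  refine measure_mono_null ?_ h1
  intro z hz
  refine ⟨?_, hz⟩
  have : t < f z := hz.2
  simp only [mem_setOf_eq, ne_eq, ENNReal.ofReal_eq_zero, not_le]
  linarith

theorem aux_cond {d : ℕ} (t : ℝ) (ht : 0 < t) (f : Ed d → ℝ) (hfC2 : ContDiff ℝ 2 f)
    (μ : Measure (Ed d)) [IsProbabilityMeasure μ]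
    (hμ : μ = MeasureTheory.volume.withDensity (fun x => ENNReal.ofReal (f x)))
    (hcrit : ∀ x, f x = t → fderiv ℝ f x ≠ 0) (x : Ed d) (hx : t ≤ f x)
    (U : Set (Ed d)) (hU : U ∈ 𝓝 x) : ProbabilityTheory.cond μ {z | t ≤ f z} U ≠ 0 := by
  have hm : MeasurableSet {z | t ≤ f z} :=
    (isClosed_le continuous_const hfC2.continuous).measurableSet
  rw [cond_apply hm]
  refine mul_ne_zero ?_ (aux_pos t ht f hfC2 μ hμ hcrit x hx U hU)
  exact ENNReal.inv_ne_zero.mpr (measure_ne_top _ _)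

theorem aux_int {d : ℕ} (L : Set (Ed d)) (hL : IsCompact L) (μ : Measure (Ed d))
    [IsProbabilityMeasure μ] (hμL : μ L ≠ 0) (g : Ed d → ℝ) (hg : ContinuousOn g L) :
    Integrable g (ProbabilityTheory.cond μ L) := by
  have h1 : IntegrableOn g L μ := hg.integrableOn_compact hL
  exact Integrable.smul_measure h1 (ENNReal.inv_ne_top.mpr hμL)

theorem kerh_supp {d : ℕ} (k : Ed d → ℝ) (h : ℝ) (hh : 0 < h)
    (hksupp : tsupport k = Metric.closedBall 0 1) (u : Ed d) (hu : kerh k h u ≠ 0) :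
    ‖u‖ ≤ h := by
  have h1 : h⁻¹ • u ∈ tsupport k := subset_tsupport k hu
  rw [hksupp, mem_closedBall_zero_iff, norm_smul, norm_inv, Real.norm_of_nonneg hh.le,
    inv_mul_le_iff₀ hh, mul_one] at h1
  exact h1

theorem kerh_pos {d : ℕ} (k : Ed d → ℝ) (h : ℝ) (hh : 0 < h)
    (hklow : ∃ c > 0, ∀ x ∈ Metric.closedBall (0 : Ed d) (1 / 2), c ≤ k x)
    (u : Ed d) (hu : ‖u‖ < h / 2) : 0 < kerh k h u := by
  obtain ⟨c, hc, hk⟩ := hklow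
  refine lt_of_lt_of_le hc (hk _ ?_)
  rw [mem_closedBall_zero_iff, norm_smul, norm_inv, Real.norm_of_nonneg hh.le,
    inv_mul_le_iff₀ hh]
  linarith

/-- Every continuous fixed function of `Q_h` is constant on each
connected component of `L(t)`; consequently the eigenspace of `Q_h` for the
eigenvalue `1` is spanned by the indicator functions `1_{C₁}, …, 1_{C_ℓ}` (which
are themselves fixed by `Q_h` and linearly independent, so that `1` is an eigenvalue
of multiplicity `ℓ`). -/
theorem stmt_14
    {d : ℕ}
    (t : ℝ) (ht : 0 < t)
    (f : Ed d → ℝ)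
    (hfC2 : ContDiff ℝ 2 f) (hf0 : ∀ x, 0 ≤ f x)
    (hfbdd : ∃ M : ℝ, ∀ x, f x ≤ M ∧ ‖fderiv ℝ f x‖ ≤ M ∧ ‖fderiv ℝ (fderiv ℝ f) x‖ ≤ M)
    (μ : Measure (Ed d)) [IsProbabilityMeasure μ]
    (hμ : μ = MeasureTheory.volume.withDensity (fun x => ENNReal.ofReal (f x)))
    (hcrit : ∀ x, f x = t → fderiv ℝ f x ≠ 0)
    (hrange : t ∈ interior (Set.range f))
    (hLtcomp : IsCompact {x | t ≤ f x})
    (h : ℝ) (hh : 0 < h)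
    (k : Ed d → ℝ)
    (hkC2 : ContDiff ℝ 2 k) (hk0 : ∀ x, 0 ≤ k x)
    (hksupp : tsupport k = Metric.closedBall 0 1)
    (hklow : ∃ c > 0, ∀ x ∈ Metric.closedBall (0 : Ed d) (1 / 2), c ≤ k x)
    (hksymm : ∀ x, k (-x) = k x)
    (ℓ : ℕ) (C : Fin ℓ → Set (Ed d))
    (hCcomp : ∀ i, ∃ x ∈ {x | t ≤ f x}, C i = connectedComponentIn {x | t ≤ f x} x)
    (hCinj : Function.Injective C)
    (hCunion : (⋃ i, C i) = {x | t ≤ f x})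
    (hdmin : ∀ i j, i ≠ j → ∀ x ∈ C i, ∀ y ∈ C j, h < dist x y)
 :
    (∀ g : Ed d → ℝ, ContinuousOn g {x | t ≤ f x} →
      (∀ x ∈ {x | t ≤ f x},
        (∫ y, qH k h (ProbabilityTheory.cond μ {z | t ≤ f z}) x y * g y ∂(ProbabilityTheory.cond μ {z | t ≤ f z})) = g x) →
      ∀ i : Fin ℓ, ∀ x ∈ C i, ∀ y ∈ C i, g x = g y) ∧
    (∀ g : Ed d → ℝ, ContinuousOn g {x | t ≤ f x} →
      (∀ x ∈ {x | t ≤ f x},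
        (∫ y, qH k h (ProbabilityTheory.cond μ {z | t ≤ f z}) x y * g y ∂(ProbabilityTheory.cond μ {z | t ≤ f z})) = g x) →
      ∃ c : Fin ℓ → ℝ, ∀ x ∈ {x | t ≤ f x},
        g x = ∑ i, c i * Set.indicator (C i) (fun _ => (1 : ℝ)) x) ∧
    (∀ i : Fin ℓ, ∀ x ∈ {x | t ≤ f x},
      (∫ y, qH k h (ProbabilityTheory.cond μ {z | t ≤ f z}) x y * Set.indicator (C i) (fun _ => (1 : ℝ)) y
          ∂(ProbabilityTheory.cond μ {z | t ≤ f z}))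
        = Set.indicator (C i) (fun _ => (1 : ℝ)) x) ∧
    LinearIndependent ℝ (fun i : Fin ℓ => Set.indicator (C i) (fun _ => (1 : ℝ))) := by
  set L : Set (Ed d) := {x | t ≤ f x} with hLdef
  set ν := ProbabilityTheory.cond μ L with hν
  have hfc : Continuous f := hfC2.continuous
  have hLcl : IsClosed L := isClosed_le continuous_const hfc
  have hpos : ∀ x ∈ L, ∀ U ∈ 𝓝 x, ν U ≠ 0 := fun x hx U hU =>
    aux_cond t ht f hfC2 μ hμ hcrit x hx U hU
  have hμL : μ L ≠ 0 := by
    obtain ⟨x, hx⟩ := interior_subset hrange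
    have := aux_pos t ht f hfC2 μ hμ hcrit x hx.ge univ univ_mem
    rwa [inter_univ] at this
  have hae : ∀ᵐ y ∂ν, y ∈ L := ae_cond_mem hLcl.measurableSet
  have hint : ∀ g : Ed d → ℝ, ContinuousOn g L → Integrable g ν := fun g hg =>
    aux_int L hLtcomp μ hμL g hg
  have hkc : ∀ x : Ed d, Continuous fun y => kerh k h (y - x) := by
    intro x
    have := hkC2.continuous
    unfold kerh
    fun_prop
  have hkn : ∀ u, 0 ≤ kerh k h u := fun u => hk0 _
  have hsubL : ∀ i, C i ⊆ L := fun i => hCunion ▸ subset_iUnion C i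
  have hCex : ∀ x ∈ L, ∃ i, x ∈ C i := by
    intro x hx
    rw [← hCunion] at hx
    exact mem_iUnion.mp hx
  have huniq : ∀ i j x, x ∈ C i → x ∈ C j → i = j := by
    intro i j x hi hj
    by_contra hij
    have := hdmin i j hij x hi x hj
    rw [dist_self] at this
    linarith
  have hstay : ∀ i, ∀ x ∈ C i, ∀ y ∈ L, kerh k h (y - x) ≠ 0 → y ∈ C i := by
    intro i x hx y hy hk
    obtain ⟨j, hj⟩ := hCex y hy
    by_cases hij : j = i
    · exact hij ▸ hj
    · have h1 := hdmin j i hij y hj x hx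
      have h2 := kerh_supp k h hh hksupp _ hk
      rw [dist_eq_norm] at h1
      linarith
  have hKpos : ∀ x ∈ L, 0 < KH k h ν x := by
    intro x hx
    unfold KH
    rw [integral_pos_iff_support_of_nonneg (fun y => hkn _) (hint _ (hkc x).continuousOn)]
    refine lt_of_lt_of_le (pos_iff_ne_zero.mpr
      (hpos x hx (ball x (h / 2)) (ball_mem_nhds _ (by positivity)))) (measure_mono ?_)
    intro y hy
    rw [mem_ball, dist_eq_norm] at hy
    exact (kerh_pos k h hh hklow _ hy).ne'
  have part1 : ∀ g : Ed d → ℝ, ContinuousOn g L →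
      (∀ x ∈ L, (∫ y, qH k h ν x y * g y ∂ν) = g x) →
      ∀ i : Fin ℓ, ∀ x ∈ C i, ∀ y ∈ C i, g x = g y := by
    intro g hg hfix i
    obtain ⟨x₀, hx₀, hCi⟩ := hCcomp i
    have hx₀C : x₀ ∈ C i := hCi ▸ mem_connectedComponentIn hx₀
    have hCpre : IsPreconnected (C i) := hCi ▸ isPreconnected_connectedComponentIn
    have hCcl : IsClosed (C i) := by
      have hss : closure (C i) ⊆ C i := by
        conv_rhs => rw [hCi]
        exact hCpre.closure.subset_connectedComponentIn (subset_closure hx₀C)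
          (closure_minimal (hsubL i) hLcl)
      exact isClosed_of_closure_subset hss
    have hCc : IsCompact (C i) := hLtcomp.of_isClosed_subset hCcl (hsubL i)
    obtain ⟨m, hm, hmax⟩ := hCc.exists_isMaxOn ⟨x₀, hx₀C⟩ (hg.mono (hsubL i))
    have hmax' : ∀ y ∈ C i, g y ≤ g m := fun y hy => hmax hy
    have key : ∀ x ∈ C i, g x = g m → ∀ y ∈ C i, dist y x < h / 2 → g y = g m := by
      intro x hx hxm y hy hyx
      by_contra hne
      have hlt : g y < g m := lt_of_le_of_ne (hmax' y hy) hne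
      have hxL := hsubL i hx
      have hyL := hsubL i hy
      have hKx := hKpos x hxL
      have h1 : ∫ y, kerh k h (y - x) * g y ∂ν = g m * KH k h ν x := by
        have h2 := hfix x hxL
        have h3 : ∀ y, qH k h ν x y * g y = (KH k h ν x)⁻¹ * (kerh k h (y - x) * g y) := by
          intro y; unfold qH; rw [div_eq_mul_inv]; ring
        simp_rw [h3] at h2
        rw [integral_const_mul, hxm] at h2
        rw [← h2]; field_simp
      have hi1 : Integrable (fun y => kerh k h (y - x)) ν := hint _ (hkc x).continuousOn
      have hi2 : Integrable (fun y => kerh k h (y - x) * g y) ν :=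
        hint _ ((hkc x).continuousOn.mul hg)
      have h0 : ∫ y, (g m * kerh k h (y - x) - kerh k h (y - x) * g y) ∂ν = 0 := by
        rw [integral_sub (hi1.const_mul _) hi2, h1, integral_const_mul]
        unfold KH; ring
      have hnn : 0 ≤ᵐ[ν] fun y => g m * kerh k h (y - x) - kerh k h (y - x) * g y := by
        filter_upwards [hae] with z hz
        by_cases hk : kerh k h (z - x) = 0
        · simp [hk]
        · have := hmax' z (hstay i x hx z hz hk)
          have := hkn (z - x)
          simp only [Pi.zero_apply]
          nlinarith
      rw [integral_eq_zero_iff_of_nonneg_ae hnn ((hi1.const_mul _).sub hi2)] at h0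
      have hnb : {z | g z < g m} ∈ 𝓝[L] y := (hg y hyL).eventually_lt_const hlt
      obtain ⟨U, hU, hUs⟩ := mem_nhdsWithin_iff_exists_mem_nhds_inter.mp hnb
      refine hpos y hyL (U ∩ ball x (h / 2)) (inter_mem hU (isOpen_ball.mem_nhds hyx)) ?_
      have : ∀ᵐ z ∂ν, z ∉ U ∩ ball x (h / 2) := by
        filter_upwards [hae, h0] with z hz hz0 hzU
        have h4 : g z < g m := hUs ⟨hzU.1, hz⟩
        have h5 := hzU.2
        rw [mem_ball, dist_eq_norm] at h5
        have h6 := kerh_pos k h hh hklow _ h5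
        simp only [Pi.zero_apply] at hz0
        nlinarith
      exact measure_eq_zero_iff_ae_notMem.mpr this
    have hall : ∀ x ∈ C i, g x = g m := by
      intro x hx
      have hcov : C i ⊆ {z | ∃ w ∈ C i, g w = g m ∧ dist z w < h / 4} ∪
          {z | ∃ w ∈ C i, g w ≠ g m ∧ dist z w < h / 4} := by
        intro z hz
        by_cases hzm : g z = g m
        · exact Or.inl ⟨z, hz, hzm, by rw [dist_self]; positivity⟩
        · exact Or.inr ⟨z, hz, hzm, by rw [dist_self]; positivity⟩
      have hop : ∀ P : Ed d → Prop, IsOpen {z | ∃ w ∈ C i, P w ∧ dist z w < h / 4} := by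
        intro P
        have : {z | ∃ w ∈ C i, P w ∧ dist z w < h / 4} =
            ⋃ w ∈ {w | w ∈ C i ∧ P w}, ball w (h / 4) := by
          ext z; simp [and_assoc]
        rw [this]
        exact isOpen_biUnion fun _ _ => isOpen_ball
      by_contra hxm
      obtain ⟨z, hz, ⟨w, hw, hwm, hzw⟩, ⟨w', hw', hwm', hzw'⟩⟩ :=
        hCpre _ _ (hop fun w => g w = g m) (hop fun w => g w ≠ g m) hcov
          ⟨m, hm, m, hm, rfl, by rw [dist_self]; positivity⟩
          ⟨x, hx, x, hx, hxm, by rw [dist_self]; positivity⟩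
      refine hwm' (key w hw hwm w' hw' ?_)
      have := dist_triangle w' z w
      rw [dist_comm w' z] at this
      linarith
    intro x hx y hy
    rw [hall x hx, hall y hy]
  have hind : ∀ (c : Fin ℓ → ℝ) (j : Fin ℓ) (x : Ed d), x ∈ C j →
      ∑ i, c i * Set.indicator (C i) (fun _ => (1 : ℝ)) x = c j := by
    intro c j x hx
    rw [Finset.sum_eq_single j]
    · rw [indicator_of_mem hx, mul_one]
    · intro i _ hij
      rw [indicator_of_notMem (fun hi => hij (huniq i j x hi hx)), mul_zero]
    · simp
  have hCne : ∀ i, ∃ x, x ∈ C i := by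
    intro i
    obtain ⟨x, hx, hi⟩ := hCcomp i
    exact ⟨x, hi ▸ mem_connectedComponentIn hx⟩
  choose p hp using hCne
  refine ⟨part1, ?_, ?_, ?_⟩
  · intro g hg hfix
    refine ⟨fun i => g (p i), fun x hx => ?_⟩
    obtain ⟨j, hj⟩ := hCex x hx
    rw [hind _ j x hj]
    exact part1 g hg hfix j x hj _ (hp j)
  · intro i x hx
    obtain ⟨j, hj⟩ := hCex x hx
    have hKx := hKpos x hx
    have h1 : (∫ y, qH k h ν x y * Set.indicator (C i) (fun _ => (1 : ℝ)) y ∂ν) =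
        ∫ y, kerh k h (y - x) *
          ((KH k h ν x)⁻¹ * Set.indicator (C i) (fun _ => (1 : ℝ)) x) ∂ν := by
      refine integral_congr_ae ?_
      filter_upwards [hae] with y hy
      unfold qH
      by_cases hk : kerh k h (y - x) = 0
      · simp [hk]
      · have hyj := hstay j x hj y hy hk
        have : Set.indicator (C i) (fun _ => (1 : ℝ)) y =
            Set.indicator (C i) (fun _ => (1 : ℝ)) x := by
          by_cases hij : i = j
          · subst hij
            rw [indicator_of_mem hyj, indicator_of_mem hj]
          · rw [indicator_of_notMem (fun hi => hij (huniq i j y hi hyj)),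
              indicator_of_notMem (fun hi => hij (huniq i j x hi hj))]
        rw [this, div_eq_mul_inv, mul_assoc]
    rw [h1, integral_mul_const]
    change KH k h ν x * _ = _
    rw [← mul_assoc, mul_inv_cancel₀ hKx.ne', one_mul]
  · rw [Fintype.linearIndependent_iff]
    intro c hc j
    have := congrFun hc (p j)
    simp only [Finset.sum_apply, Pi.smul_apply, smul_eq_mul, Pi.zero_apply] at this
    rw [hind c j (p j) (hp j)] at this
    exact this
end
end
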